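/- Let n ≥ 1, let F : ℝⁿ → ℝⁿ be continuously differentiable, and let V : (0,∞) → ℝⁿ be a bounded function of bounded total variation such that U(t,x) := V(x/t) is a distributional solution of ∂ₜU + ∂ₓF(U) = 0 on (0,∞) × (0,∞). Let ξ₀ > 0 be a point at which V is continuous and differentiable, and such that V is not almost everywhere constant on any open neighborhood of ξ₀. Then the derivative V′(ξ₀) satisfies DF(V(ξ₀)) V′(ξ₀) = ξ₀ · V′(ξ₀); in other words, V′(ξ₀) is either zero or an eigenvector of DF(V(ξ₀)) corresponding to the eigenvalue ξ₀. -/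

import Mathlib

open Matrix MeasureTheory

/-- The Jacobian matrix of `F : ℝⁿ → ℝⁿ` at `U`: the `(i, j)` entry is `∂ⱼ Fᵢ (U)`. -/
noncomputable def jacobianMatrix {n : ℕ} (F : (Fin n → ℝ) → (Fin n → ℝ))
    (U : Fin n → ℝ) : Matrix (Fin n) (Fin n) ℝ :=
  Matrix.of fun i j => fderiv ℝ F U (Pi.single j 1) i

/-- `U(t,x) := V(x/t)` is a self-similar distributional solution of
`∂ₜU + ∂ₓF(U) = 0` on `(0,∞) × (0,∞)`. -/
def IsSelfSimilarSolution (n : ℕ) (F : (Fin n → ℝ) → (Fin n → ℝ))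
    (V : ℝ → Fin n → ℝ) : Prop :=
  ∀ φ : ℝ × ℝ → Fin n → ℝ, ContDiff ℝ (⊤ : ℕ∞) φ → HasCompactSupport φ →
    tsupport φ ⊆ Set.Ioi (0 : ℝ) ×ˢ Set.Ioi (0 : ℝ) →
    ∫ p : ℝ × ℝ,
      ((V (p.2 / p.1)) ⬝ᵥ (fderiv ℝ φ p (1, 0)) +
        (F (V (p.2 / p.1))) ⬝ᵥ (fderiv ℝ φ p (0, 1))) = 0

open Filter Topology
open scoped ContDiff

theorem integral_id_mul_deriv {ψ : ℝ → ℝ} (hψ : ContDiff ℝ ∞ ψ) (hc : HasCompactSupport ψ) :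
    ∫ y, y * deriv ψ y = -∫ y, ψ y := by
  have hψ' : Continuous (deriv ψ) := hψ.continuous_deriv (by simp)
  have h1 : Integrable fun y => y * deriv ψ y :=
    (continuous_id.mul hψ').integrable_of_hasCompactSupport hc.deriv.mul_left
  have h2 : Integrable ψ := hψ.continuous.integrable_of_hasCompactSupport hc
  have h3 : Integrable fun y => y * ψ y :=
    (continuous_id.mul hψ.continuous).integrable_of_hasCompactSupport hc.mul_left
  have h := integral_eq_zero_of_hasDerivAt_of_integrable
    (f := fun y => y * ψ y) (f' := fun y => 1 * ψ y + y * deriv ψ y)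
    (fun y => (hasDerivAt_id y).mul (hψ.differentiable (by simp) y).hasDerivAt)
    (by simp only [one_mul]; exact h2.add h1) h3
  simp only [one_mul] at h
  rw [integral_add h2 h1] at h
  linarith

theorem integrable_mul_comp_div {c d : ℝ → ℝ} (hc : Measurable c) (hd : Measurable d)
    (hci : Integrable fun t => c t * |t|) (hdi : Integrable d) :
    Integrable fun p : ℝ × ℝ => c p.1 * d (p.2 / p.1) := by
  have hm : Measurable fun p : ℝ × ℝ => c p.1 * d (p.2 / p.1) := by fun_prop
  refine (integrable_prod_iff hm.aestronglyMeasurable).2 ⟨?_, ?_⟩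
  · filter_upwards [Measure.ae_ne volume (0 : ℝ)] with t ht
    exact (hdi.comp_div ht).const_mul _
  · refine (hci.norm.mul_const (∫ y, ‖d y‖)).congr (ae_of_all _ fun t => ?_)
    simp only [norm_mul]
    rw [integral_const_mul, Measure.integral_comp_div (fun y => ‖d y‖) t]
    simp [mul_assoc]

theorem integral_mul_comp_div {c d : ℝ → ℝ} (hc : Measurable c) (hd : Measurable d)
    (hci : Integrable fun t => c t * |t|) (hdi : Integrable d) :
    ∫ p : ℝ × ℝ, c p.1 * d (p.2 / p.1) = (∫ t, c t * |t|) * ∫ y, d y := by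
  rw [Measure.volume_eq_prod, integral_prod _ (integrable_mul_comp_div hc hd hci hdi),
    ← integral_mul_const]
  congr with t
  simp only
  rw [integral_const_mul, Measure.integral_comp_div d t]
  simp [mul_assoc]

theorem BoundedVariationOn.measurable_indicator_Ioi {f : ℝ → ℝ}
    (hf : BoundedVariationOn f (Set.Ioi 0)) : Measurable ((Set.Ioi 0).indicator f) := by
  have hexp : BoundedVariationOn (f ∘ Real.exp) Set.univ :=
    ne_top_of_le_ne_top hf (eVariationOn.comp_le_of_monotoneOn f Real.exp
      (Real.exp_monotone.monotoneOn _) fun x _ => Real.exp_pos x)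
  obtain ⟨p, q, hp, hq, hpq⟩ :=
    hexp.locallyBoundedVariationOn.exists_monotoneOn_sub_monotoneOn
  have hm : Measurable (f ∘ Real.exp) := by
    rw [hpq]
    exact (monotoneOn_univ.1 hp).measurable.sub (monotoneOn_univ.1 hq).measurable
  convert (hm.comp Real.measurable_log).indicator (measurableSet_Ioi (a := (0 : ℝ))) using 1
  ext x
  by_cases hx : x ∈ Set.Ioi (0 : ℝ)
  · simp [hx, Real.exp_log hx]
  · simp [hx]

/-- If `g' = -a` weakly on the half-line, then the same holds at each point where `g` is
differentiable and `a` is continuous. -/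
theorem deriv_eq_neg_of_weak {g a : ℝ → ℝ} (hg : Measurable g) (ha : Measurable a)
    (hgi : LocallyIntegrable g) (hai : LocallyIntegrable a)
    (hw : ∀ ψ : ℝ → ℝ, ContDiff ℝ ∞ ψ → HasCompactSupport ψ → tsupport ψ ⊆ Set.Ioi 0 →
      ∫ x, (g x * deriv ψ x - a x * ψ x) = 0)
    {ξ₀ g' : ℝ} (hξ₀ : 0 < ξ₀) (hgd : HasDerivAt g g' ξ₀) (hac : ContinuousAt a ξ₀) :
    g' = -a ξ₀ := by
  let β : ContDiffBump (0 : ℝ) := ⟨1, 2, one_pos, one_lt_two⟩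
  have hβ : ContDiff ℝ ∞ β := β.contDiff
  have hβc : HasCompactSupport β := β.hasCompactSupport
  have hβ' : Continuous (deriv β) := hβ.continuous_deriv (by simp)
  have hβi : Integrable β := hβ.continuous.integrable_of_hasCompactSupport hβc
  have hβ'i : Integrable (deriv β) := hβ'.integrable_of_hasCompactSupport hβc.deriv
  have hyβ' : Integrable fun y => y * deriv β y :=
    (continuous_id.mul hβ').integrable_of_hasCompactSupport hβc.deriv.mul_left
  have hsupp : ∀ y, y ∉ Metric.closedBall (0 : ℝ) 2 → β y = 0 ∧ deriv β y = 0 := by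
    intro y hy
    have hy' : y ∉ tsupport β := by rwa [β.tsupport_eq]
    exact ⟨image_eq_zero_of_notMem_tsupport hy',
      Function.notMem_support.1 fun h => hy' (support_deriv_subset h)⟩
  -- Test against `β ((x - ξ₀) / ε)` and rescale.
  have hscale : ∀ᶠ ε in 𝓝[>] (0 : ℝ),
      ∫ y, ((g (ξ₀ + ε * y) - g ξ₀) / ε * deriv β y - a (ξ₀ + ε * y) * β y) = 0 := by
    filter_upwards [Ioo_mem_nhdsGT (show (0 : ℝ) < ξ₀ / 2 by positivity)] with ε hε
    obtain ⟨hε0, hε⟩ := hε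
    set ψ : ℝ → ℝ := fun x => β ((x - ξ₀) / ε) with hψdef
    have hψ : ContDiff ℝ ∞ ψ := hβ.comp ((contDiff_id.sub contDiff_const).div_const _)
    have hψ0 : Function.support ψ ⊆ Metric.closedBall ξ₀ (2 * ε) := by
      intro x hx
      by_contra hx'
      refine hx (hsupp _ fun h => hx' ?_).1
      rw [Metric.mem_closedBall, Real.dist_eq] at h ⊢
      rwa [sub_zero, abs_div, abs_of_pos hε0, div_le_iff₀ hε0] at h
    have hψc : HasCompactSupport ψ :=
      HasCompactSupport.of_support_subset_isCompact (isCompact_closedBall _ _) hψ0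
    have hψt : tsupport ψ ⊆ Set.Ioi 0 := by
      refine (closure_minimal hψ0 Metric.isClosed_closedBall).trans fun x hx => ?_
      rw [Metric.mem_closedBall, Real.dist_eq, abs_le] at hx
      rw [Set.mem_Ioi]
      linarith [hx.1]
    have hψd : ∀ x, deriv ψ x = deriv β ((x - ξ₀) / ε) / ε := by
      intro x
      have h1 : HasDerivAt (fun x => (x - ξ₀) / ε) (1 / ε) x :=
        ((hasDerivAt_id x).sub_const ξ₀).div_const ε
      have h2 := (hβ.differentiable (by simp) ((x - ξ₀) / ε)).hasDerivAt.comp x h1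
      rw [show ψ = β ∘ fun x => (x - ξ₀) / ε from rfl, h2.deriv]
      ring
    have hψ' : Continuous (deriv ψ) := hψ.continuous_deriv (by simp)
    have hψ'0 : ∫ x, deriv ψ x = 0 :=
      integral_eq_zero_of_hasDerivAt_of_integrable
        (fun y => (hψ.differentiable (by simp) y).hasDerivAt)
        (hψ'.integrable_of_hasCompactSupport hψc.deriv)
        (hψ.continuous.integrable_of_hasCompactSupport hψc)
    have h1 : Integrable fun x => g x * deriv ψ x - a x * ψ x :=
      (hgi.integrable_smul_right_of_hasCompactSupport hψ' hψc.deriv).sub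
        (hai.integrable_smul_right_of_hasCompactSupport hψ.continuous hψc)
    have h2 : Integrable fun x => g ξ₀ * deriv ψ x :=
      (hψ'.integrable_of_hasCompactSupport hψc.deriv).const_mul _
    have h3 : ∫ x, ((g x - g ξ₀) * deriv ψ x - a x * ψ x) = 0 := by
      have h4 := integral_sub h1 h2
      rw [hw ψ hψ hψc hψt, integral_const_mul, hψ'0, mul_zero, sub_zero] at h4
      rw [← h4]
      congr with x
      ring
    have h5 := Measure.integral_comp_mul_left
      (fun z => (g (ξ₀ + z) - g ξ₀) * deriv ψ (ξ₀ + z) - a (ξ₀ + z) * ψ (ξ₀ + z)) ε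
    rw [integral_add_left_eq_self (fun x => (g x - g ξ₀) * deriv ψ x - a x * ψ x), h3,
      smul_zero] at h5
    refine Eq.trans ?_ h5
    congr with y
    rw [hψd, hψdef]
    simp only [add_sub_cancel_left, mul_div_cancel_left₀ _ hε0.ne']
    ring
  have hlim : Tendsto (fun ε => ∫ y, ((g (ξ₀ + ε * y) - g ξ₀) / ε * deriv β y
      - a (ξ₀ + ε * y) * β y)) (𝓝[>] 0) (𝓝 (∫ y, (g' * (y * deriv β y) - a ξ₀ * β y))) := by
    obtain ⟨C, hC⟩ := hgd.isBigO_sub.bound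
    have hA : ∀ᶠ x in 𝓝 ξ₀, ‖a x‖ ≤ ‖a ξ₀‖ + 1 :=
      (hac.norm.eventually_lt_const (lt_add_one _)).mono fun x hx => hx.le
    obtain ⟨δ, hδ, hball⟩ := Metric.eventually_nhds_iff.1 (hC.and hA)
    refine tendsto_integral_filter_of_dominated_convergence
      (fun y => C * ‖y * deriv β y‖ + (‖a ξ₀‖ + 1) * ‖β y‖) ?_ ?_ ?_ ?_
    · refine Eventually.of_forall fun ε => Measurable.aestronglyMeasurable ?_
      have := hβ'.measurable
      have := hβ.continuous.measurable
      fun_prop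
    · filter_upwards [Ioo_mem_nhdsGT (show (0 : ℝ) < δ / 2 by positivity)] with ε hε
      obtain ⟨hε0, hε⟩ := hε
      refine ae_of_all _ fun y => ?_
      by_cases hy : y ∈ Metric.closedBall (0 : ℝ) 2
      · rw [Metric.mem_closedBall, dist_zero_right, Real.norm_eq_abs] at hy
        have hd : dist (ξ₀ + ε * y) ξ₀ < δ := by
          rw [Real.dist_eq, add_sub_cancel_left, abs_mul, abs_of_pos hε0]
          nlinarith
        obtain ⟨hd1, hd2⟩ := hball hd
        refine (norm_sub_le _ _).trans (add_le_add ?_ ?_)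
        · rw [norm_mul, norm_mul, ← mul_assoc]
          refine mul_le_mul_of_nonneg_right ?_ (norm_nonneg _)
          rw [norm_div, Real.norm_of_nonneg hε0.le, div_le_iff₀ hε0]
          refine hd1.trans_eq ?_
          rw [add_sub_cancel_left, norm_mul, Real.norm_of_nonneg hε0.le]
          ring
        · rw [norm_mul]
          exact mul_le_mul_of_nonneg_right hd2 (norm_nonneg _)
      · simp [hsupp y hy]
    · exact (hyβ'.norm.const_mul _).add (hβi.norm.const_mul _)
    · refine ae_of_all _ fun y => ?_
      have hline : HasDerivAt (fun ε : ℝ => ξ₀ + ε * y) y 0 := by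
        simpa using ((hasDerivAt_id (0 : ℝ)).mul_const y).const_add ξ₀
      have hcomp : HasDerivAt (fun ε => g (ξ₀ + ε * y)) (g' * y) 0 :=
        HasDerivAt.comp (h₂ := g) 0 (by simpa using hgd) hline
      have hslope := hcomp.tendsto_slope_zero_right
      have hac' : Tendsto (fun ε => a (ξ₀ + ε * y)) (𝓝[>] 0) (𝓝 (a ξ₀)) := by
        refine hac.tendsto.comp (tendsto_nhdsWithin_of_tendsto_nhds ?_)
        simpa using hline.continuousAt.tendsto
      have := (hslope.mul_const (deriv β y)).sub (hac'.mul_const (β y))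
      rw [mul_assoc] at this
      refine this.congr fun ε => ?_
      simp [div_eq_inv_mul]
  have hzero := tendsto_nhds_unique (hlim.congr' hscale) tendsto_const_nhds
  rw [integral_sub (hyβ'.const_mul _) (hβi.const_mul _), integral_const_mul, integral_const_mul,
    integral_id_mul_deriv hβ hβc] at hzero
  have hpos : 0 < ∫ y, β y := β.integral_pos
  have : (g' + a ξ₀) * ∫ y, β y = 0 := by linarith
  linarith [(mul_eq_zero.1 this).resolve_right hpos.ne']

/-- The test function `(t, x) ↦ χ t * ψ (x / t)` adapted to the self-similar structure. -/
noncomputable def selfSimilarTest (χ ψ : ℝ → ℝ) (p : ℝ × ℝ) : ℝ := χ p.1 * ψ (p.2 / p.1)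

theorem support_selfSimilarTest_subset {χ ψ : ℝ → ℝ} (hχ : tsupport χ ⊆ Set.Ioi 0) :
    Function.support (selfSimilarTest χ ψ) ⊆
      (fun q : ℝ × ℝ => (q.1, q.1 * q.2)) '' (tsupport χ ×ˢ tsupport ψ) := by
  rintro ⟨t, x⟩ h
  have ht : t ∈ tsupport χ := subset_tsupport _ (left_ne_zero_of_mul h)
  have hx : x / t ∈ tsupport ψ := subset_tsupport _ (right_ne_zero_of_mul h)
  have ht0 : t ≠ 0 := (hχ ht).ne'
  exact ⟨(t, x / t), ⟨ht, hx⟩, by simp [mul_div_cancel₀, ht0]⟩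

theorem isCompact_image_tsupport {χ ψ : ℝ → ℝ} (hχ : HasCompactSupport χ)
    (hψ : HasCompactSupport ψ) :
    IsCompact ((fun q : ℝ × ℝ => (q.1, q.1 * q.2)) '' (tsupport χ ×ˢ tsupport ψ)) :=
  (hχ.isCompact.prod hψ.isCompact).image (by fun_prop)

theorem hasCompactSupport_selfSimilarTest {χ ψ : ℝ → ℝ} (hχc : HasCompactSupport χ)
    (hχ : tsupport χ ⊆ Set.Ioi 0) (hψc : HasCompactSupport ψ) :
    HasCompactSupport (selfSimilarTest χ ψ) :=
  .of_support_subset_isCompact (isCompact_image_tsupport hχc hψc)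
    (support_selfSimilarTest_subset hχ)

theorem tsupport_selfSimilarTest_subset {χ ψ : ℝ → ℝ} (hχc : HasCompactSupport χ)
    (hχ : tsupport χ ⊆ Set.Ioi 0) (hψc : HasCompactSupport ψ) (hψ : tsupport ψ ⊆ Set.Ioi 0) :
    tsupport (selfSimilarTest χ ψ) ⊆ Set.Ioi (0 : ℝ) ×ˢ Set.Ioi (0 : ℝ) := by
  refine (closure_minimal (support_selfSimilarTest_subset hχ)
    (isCompact_image_tsupport hχc hψc).isClosed).trans ?_
  rintro _ ⟨⟨t, y⟩, ⟨ht, hy⟩, rfl⟩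
  exact ⟨hχ ht, mul_pos (Set.mem_Ioi.1 (hχ ht)) (Set.mem_Ioi.1 (hψ hy))⟩

theorem eventually_eq_zero_of_tsupport_subset_Ioi {χ : ℝ → ℝ} (hχ : tsupport χ ⊆ Set.Ioi 0) :
    ∀ᶠ t in 𝓝 (0 : ℝ), χ t = 0 :=
  notMem_tsupport_iff_eventuallyEq.1 fun h => lt_irrefl (0 : ℝ) (hχ h)

theorem contDiff_selfSimilarTest {χ ψ : ℝ → ℝ} (hχ : ContDiff ℝ ∞ χ) (hψ : ContDiff ℝ ∞ ψ)
    (hχs : tsupport χ ⊆ Set.Ioi 0) : ContDiff ℝ ∞ (selfSimilarTest χ ψ) := by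
  refine contDiff_iff_contDiffAt.2 fun p => ?_
  by_cases hp : p.1 = 0
  · have h0 : selfSimilarTest χ ψ =ᶠ[𝓝 p] fun _ => 0 := by
      have h1 : Tendsto Prod.fst (𝓝 p) (𝓝 (0 : ℝ)) := hp ▸ continuous_fst.continuousAt
      filter_upwards [h1.eventually (eventually_eq_zero_of_tsupport_subset_Ioi hχs)] with q hq
      simp [selfSimilarTest, hq]
    exact contDiffAt_const.congr_of_eventuallyEq h0
  · exact (hχ.contDiffAt.comp p contDiffAt_fst).mul
      (hψ.contDiffAt.comp p (contDiffAt_snd.div contDiffAt_fst hp))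

theorem fderiv_selfSimilarTest_fst {χ ψ : ℝ → ℝ} (hχ : ContDiff ℝ ∞ χ) (hψ : ContDiff ℝ ∞ ψ)
    (hχs : tsupport χ ⊆ Set.Ioi 0) (p : ℝ × ℝ) :
    fderiv ℝ (selfSimilarTest χ ψ) p (1, 0) =
      deriv χ p.1 * ψ (p.2 / p.1) - χ p.1 / p.1 * (p.2 / p.1 * deriv ψ (p.2 / p.1)) := by
  obtain ⟨t, x⟩ := p
  have hd : HasDerivAt (fun s => selfSimilarTest χ ψ (s, x))
      (fderiv ℝ (selfSimilarTest χ ψ) (t, x) (1, 0)) t :=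
    ((contDiff_selfSimilarTest hχ hψ hχs).differentiable (by simp) (t, x)).hasFDerivAt
      |>.comp_hasDerivAt (f := fun s => (s, x)) t ((hasDerivAt_id t).prodMk (hasDerivAt_const t x))
  refine hd.unique ?_
  by_cases ht : t = 0
  · subst ht
    have h0 := eventually_eq_zero_of_tsupport_subset_Ioi hχs
    have hχ' : deriv χ 0 = 0 := by
      rw [EventuallyEq.deriv_eq (f := fun _ => 0) h0, deriv_const]
    have : (fun s => selfSimilarTest χ ψ (s, x)) =ᶠ[𝓝 0] fun _ => 0 := by
      filter_upwards [h0] with s hs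
      simp [selfSimilarTest, hs]
    simpa [hχ'] using (hasDerivAt_const (0 : ℝ) (0 : ℝ)).congr_of_eventuallyEq this
  · have h1 := (hχ.differentiable (by simp) t).hasDerivAt
    have h2 := (hψ.differentiable (by simp) (x / t)).hasDerivAt.comp t
      ((hasDerivAt_const t x).div (hasDerivAt_id t) ht)
    refine (h1.mul h2).congr_deriv ?_
    simp only [Function.comp_apply]
    field_simp
    ring

theorem fderiv_selfSimilarTest_snd {χ ψ : ℝ → ℝ} (hχ : ContDiff ℝ ∞ χ) (hψ : ContDiff ℝ ∞ ψ)
    (hχs : tsupport χ ⊆ Set.Ioi 0) (p : ℝ × ℝ) :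
    fderiv ℝ (selfSimilarTest χ ψ) p (0, 1) = χ p.1 / p.1 * deriv ψ (p.2 / p.1) := by
  obtain ⟨t, x⟩ := p
  have hd : HasDerivAt (fun z => selfSimilarTest χ ψ (t, z))
      (fderiv ℝ (selfSimilarTest χ ψ) (t, x) (0, 1)) x :=
    ((contDiff_selfSimilarTest hχ hψ hχs).differentiable (by simp) (t, x)).hasFDerivAt
      |>.comp_hasDerivAt (f := fun z => (t, z)) x ((hasDerivAt_const x t).prodMk (hasDerivAt_id x))
  refine hd.unique ?_
  have h2 := (hψ.differentiable (by simp) (x / t)).hasDerivAt.comp x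
    ((hasDerivAt_id x).div_const t)
  refine (h2.const_mul (χ t)).congr_deriv ?_
  ring

/-- The profile `a` of a self-similar solution of `∂ₜ a(x/t) + ∂ₓ b(x/t) = 0` satisfies
`(b - x a)' = -a` weakly on the half-line. -/
theorem weak_profile_equation {a b : ℝ → ℝ} (ha : Measurable a) (hb : Measurable b)
    (hai : LocallyIntegrable a) (hbi : LocallyIntegrable b)
    (hsol : ∀ φ : ℝ × ℝ → ℝ, ContDiff ℝ ∞ φ → HasCompactSupport φ →
      tsupport φ ⊆ Set.Ioi (0 : ℝ) ×ˢ Set.Ioi (0 : ℝ) →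
      ∫ p : ℝ × ℝ, (a (p.2 / p.1) * fderiv ℝ φ p (1, 0) +
        b (p.2 / p.1) * fderiv ℝ φ p (0, 1)) = 0)
    {ψ : ℝ → ℝ} (hψ : ContDiff ℝ ∞ ψ) (hψc : HasCompactSupport ψ)
    (hψs : tsupport ψ ⊆ Set.Ioi 0) :
    ∫ x, ((b x - x * a x) * deriv ψ x - a x * ψ x) = 0 := by
  let χ : ContDiffBump (2 : ℝ) := ⟨1 / 2, 1, by norm_num, by norm_num⟩
  have hχ : ContDiff ℝ ∞ χ := χ.contDiff
  have hχc : HasCompactSupport χ := χ.hasCompactSupport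
  have hχs : tsupport χ ⊆ Set.Ioi 0 := by
    rw [χ.tsupport_eq]
    intro t ht
    rw [Metric.mem_closedBall, Real.dist_eq, abs_le] at ht
    rw [Set.mem_Ioi]
    linarith [ht.1]
  have hχ' : Continuous (deriv χ) := hχ.continuous_deriv (by simp)
  have hψ' : Continuous (deriv ψ) := hψ.continuous_deriv (by simp)
  have hχi : Integrable χ := hχ.continuous.integrable_of_hasCompactSupport hχc
  have hc₁ : ∀ t, deriv χ t * |t| = t * deriv χ t := by
    intro t
    by_cases ht : t ∈ tsupport χ
    · rw [abs_of_pos (hχs ht), mul_comm]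
    · have : deriv χ t = 0 := Function.notMem_support.1 fun h => ht (support_deriv_subset h)
      simp [this]
  have hc₂ : ∀ t, χ t / t * |t| = χ t := by
    intro t
    by_cases ht : t ∈ tsupport χ
    · rw [abs_of_pos (hχs ht), div_mul_cancel₀ _ (hχs ht).ne']
    · simp [image_eq_zero_of_notMem_tsupport ht]
  have hci₁ : Integrable fun t => deriv χ t * |t| := by
    simp only [hc₁]
    exact (continuous_id.mul hχ').integrable_of_hasCompactSupport hχc.deriv.mul_left
  have hci₂ : Integrable fun t => χ t / t * |t| := by
    simpa only [hc₂] using hχi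
  have hcm₁ : Measurable (deriv χ) := hχ'.measurable
  have hcm₂ : Measurable fun t => χ t / t := hχ.continuous.measurable.div measurable_id
  have hψm := hψ.continuous.measurable
  have hψm' := hψ'.measurable
  have hdi₁ : Integrable fun y => a y * ψ y :=
    hai.integrable_smul_right_of_hasCompactSupport hψ.continuous hψc
  have hdi₂ : Integrable fun y => a y * (y * deriv ψ y) :=
    hai.integrable_smul_right_of_hasCompactSupport (continuous_id.mul hψ') hψc.deriv.mul_left
  have hdi₃ : Integrable fun y => b y * deriv ψ y :=
    hbi.integrable_smul_right_of_hasCompactSupport hψ' hψc.deriv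
  have hdi : Integrable fun y => b y * deriv ψ y - a y * (y * deriv ψ y) := hdi₃.sub hdi₂
  have hdm₁ : Measurable fun y => a y * ψ y := by fun_prop
  have hdm : Measurable fun y => b y * deriv ψ y - a y * (y * deriv ψ y) := by fun_prop
  have h := hsol _ (contDiff_selfSimilarTest hχ hψ hχs)
    (hasCompactSupport_selfSimilarTest hχc hχs hψc)
    (tsupport_selfSimilarTest_subset hχc hχs hψc hψs)
  have hsplit : ∀ p : ℝ × ℝ,
      a (p.2 / p.1) * fderiv ℝ (selfSimilarTest χ ψ) p (1, 0) +
        b (p.2 / p.1) * fderiv ℝ (selfSimilarTest χ ψ) p (0, 1) =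
      deriv χ p.1 * (fun y => a y * ψ y) (p.2 / p.1) + (fun t => χ t / t) p.1 *
        (fun y => b y * deriv ψ y - a y * (y * deriv ψ y)) (p.2 / p.1) := by
    intro p
    rw [fderiv_selfSimilarTest_fst hχ hψ hχs, fderiv_selfSimilarTest_snd hχ hψ hχs]
    ring
  rw [integral_congr_ae (ae_of_all _ hsplit),
    integral_add (integrable_mul_comp_div hcm₁ hdm₁ hci₁ hdi₁)
      (integrable_mul_comp_div hcm₂ hdm hci₂ hdi),
    integral_mul_comp_div hcm₁ hdm₁ hci₁ hdi₁, integral_mul_comp_div hcm₂ hdm hci₂ hdi] at h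
  simp only [hc₁, hc₂] at h
  rw [integral_id_mul_deriv hχ hχc] at h
  have hpos : 0 < ∫ t, χ t := χ.integral_pos
  have hprod : (∫ t, χ t) *
      ((∫ y, (b y * deriv ψ y - a y * (y * deriv ψ y))) - ∫ y, a y * ψ y) = 0 := by
    linarith
  rw [← integral_sub hdi hdi₁] at hprod
  refine Eq.trans ?_ ((mul_eq_zero.1 hprod).resolve_left hpos.ne')
  congr with y
  ring

theorem jacobianMatrix_mulVec {n : ℕ} (F : (Fin n → ℝ) → (Fin n → ℝ)) (U v : Fin n → ℝ) :
    jacobianMatrix F U *ᵥ v = fderiv ℝ F U v := by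
  have h : jacobianMatrix F U = LinearMap.toMatrix' (fderiv ℝ F U : (Fin n → ℝ) →ₗ[ℝ] _) := by
    ext i j
    simp [jacobianMatrix, LinearMap.toMatrix'_apply]
  rw [h, LinearMap.toMatrix'_mulVec]
  rfl

/-- The components of a self-similar solution, with the profile set to zero off the half-line,
satisfy scalar weak equations. -/
theorem IsSelfSimilarSolution.integral_component_eq_zero {n : ℕ}
    {F : (Fin n → ℝ) → (Fin n → ℝ)} {V : ℝ → Fin n → ℝ} (hsol : IsSelfSimilarSolution n F V)
    (i : Fin n) {φ : ℝ × ℝ → ℝ} (hφ : ContDiff ℝ ∞ φ) (hφc : HasCompactSupport φ)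
    (hφs : tsupport φ ⊆ Set.Ioi (0 : ℝ) ×ˢ Set.Ioi (0 : ℝ)) :
    ∫ p : ℝ × ℝ, ((Set.Ioi 0).indicator V (p.2 / p.1) i * fderiv ℝ φ p (1, 0) +
      F ((Set.Ioi 0).indicator V (p.2 / p.1)) i * fderiv ℝ φ p (0, 1)) = 0 := by
  have hsupp : tsupport (fun p => φ p • (Pi.single i 1 : Fin n → ℝ)) ⊆ tsupport φ :=
    closure_mono fun p hp => left_ne_zero_of_smul hp
  have h := hsol (fun p => φ p • Pi.single i 1) (hφ.smul contDiff_const) hφc.smul_right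
    (hsupp.trans hφs)
  refine Eq.trans ?_ h
  congr with p
  have hd : fderiv ℝ (fun p => φ p • (Pi.single i 1 : Fin n → ℝ)) p =
      (fderiv ℝ φ p).smulRight (Pi.single i 1) :=
    fderiv_smul_const (hφ.differentiable (by simp) p) _
  simp only [hd, ContinuousLinearMap.smulRight_apply, dotProduct_smul, dotProduct_single_one,
    smul_eq_mul]
  by_cases hp : p ∈ tsupport φ
  · have hpos : p.2 / p.1 ∈ Set.Ioi (0 : ℝ) :=
      div_pos (Set.mem_Ioi.1 (hφs hp).2) (Set.mem_Ioi.1 (hφs hp).1)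
    simp only [Set.indicator_of_mem hpos]
    ring
  · have h0 : fderiv ℝ φ p = 0 :=
      Function.notMem_support.1 fun h => hp (support_fderiv_subset ℝ h)
    simp [h0]

theorem locallyIntegrable_of_forall_abs_le {f : ℝ → ℝ} (hf : Measurable f) {M : ℝ}
    (hM : ∀ x, |f x| ≤ M) : LocallyIntegrable f :=
  (locallyIntegrable_const M).mono hf.aestronglyMeasurable
    (ae_of_all _ fun x => (hM x).trans (le_abs_self M))

/-- second half of part (3) of Lemma 2.1. If `ξ₀ > 0` is a point of
continuity and differentiability of `V` at which `V` is not a.e. constant on any open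
neighborhood, then the derivative `V′(ξ₀)` satisfies
`DF(V(ξ₀)) V′(ξ₀) = ξ₀ • V′(ξ₀)`; i.e. `V′(ξ₀)` is either zero or an eigenvector of
`DF(V(ξ₀))` for the eigenvalue `ξ₀`. -/
theorem derivative_is_eigenvector (n : ℕ) (hn : 1 ≤ n)
    (F : (Fin n → ℝ) → (Fin n → ℝ)) (hF : ContDiff ℝ 1 F)
    (V : ℝ → Fin n → ℝ)
    (hbd : ∃ M : ℝ, ∀ ξ, 0 < ξ → ‖V ξ‖ ≤ M)
    (hBV : BoundedVariationOn V (Set.Ioi 0))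
    (hsol : IsSelfSimilarSolution n F V)
    (ξ₀ : ℝ) (hξ₀ : 0 < ξ₀)
    (hcont : ContinuousAt V ξ₀)
    (V' : Fin n → ℝ) (hdiff : HasDerivAt V V' ξ₀)
    (hnc : ∀ ε > (0 : ℝ), ¬ ∃ c : Fin n → ℝ,
      ∀ᵐ ξ ∂(volume : Measure ℝ), ξ ∈ Set.Ioo (ξ₀ - ε) (ξ₀ + ε) → V ξ = c) :
    (jacobianMatrix F (V ξ₀)) *ᵥ V' = ξ₀ • V' := by
  obtain ⟨M, hM⟩ := hbd
  set W : ℝ → Fin n → ℝ := (Set.Ioi 0).indicator V with hW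
  have hWV : W =ᶠ[𝓝 ξ₀] V := by
    filter_upwards [Ioi_mem_nhds hξ₀] with x hx
    exact Set.indicator_of_mem hx V
  have hWm : Measurable W := by
    refine measurable_pi_iff.2 fun i => ?_
    have hi : BoundedVariationOn (fun x => V x i) (Set.Ioi 0) :=
      (LipschitzWith.eval i).comp_boundedVariationOn hBV
    convert hi.measurable_indicator_Ioi using 1
    ext x
    by_cases hx : x ∈ Set.Ioi (0 : ℝ) <;> simp [hW, hx]
  have hWM : ∀ x, W x ∈ Metric.closedBall (0 : Fin n → ℝ) (max M 0) := by
    intro x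
    rw [mem_closedBall_zero_iff]
    by_cases hx : x ∈ Set.Ioi (0 : ℝ)
    · rw [hW, Set.indicator_of_mem hx]
      exact (hM x hx).trans (le_max_left _ _)
    · simp [hW, hx]
  obtain ⟨N, hN⟩ := (isCompact_closedBall (0 : Fin n → ℝ) (max M 0)).exists_bound_of_continuousOn
    hF.continuous.continuousOn
  have hWd : HasDerivAt W V' ξ₀ := hdiff.congr_of_eventuallyEq hWV
  have hW₀ : W ξ₀ = V ξ₀ := hWV.eq_of_nhds
  have hFd : HasDerivAt (F ∘ W) (fderiv ℝ F (V ξ₀) V') ξ₀ := by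
    rw [← hW₀]
    exact (hF.differentiable one_ne_zero (W ξ₀)).hasFDerivAt.comp_hasDerivAt ξ₀ hWd
  rw [jacobianMatrix_mulVec]
  ext i
  have ham : Measurable fun x => W x i := (measurable_pi_apply i).comp hWm
  have hbm : Measurable fun x => F (W x) i :=
    (measurable_pi_apply i).comp (hF.continuous.measurable.comp hWm)
  have hai : LocallyIntegrable fun x => W x i :=
    locallyIntegrable_of_forall_abs_le ham fun x =>
      (norm_le_pi_norm (W x) i).trans (mem_closedBall_zero_iff.1 (hWM x))
  have hbi : LocallyIntegrable fun x => F (W x) i :=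
    locallyIntegrable_of_forall_abs_le hbm fun x =>
      (norm_le_pi_norm (F (W x)) i).trans (hN _ (hWM x))
  have had := hasDerivAt_pi.1 hWd i
  have hbd' := hasDerivAt_pi.1 hFd i
  have hxi : LocallyIntegrable fun x => x * W x i := by
    simpa using! hai.continuous_smul continuous_id
  have key := deriv_eq_neg_of_weak (g := fun x => F (W x) i - x * W x i) (a := fun x => W x i)
    (hbm.sub (measurable_id.mul ham)) ham (hbi.sub hxi) hai
    (fun ψ hψ hψc hψs => weak_profile_equation ham hbm hai hbi
      (fun φ hφ hφc hφs => hsol.integral_component_eq_zero i hφ hφc hφs) hψ hψc hψs)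
    hξ₀ (hbd'.sub ((hasDerivAt_id ξ₀).mul had)) had.continuousAt
  simp only [id, one_mul] at key
  simp only [Pi.smul_apply, smul_eq_mul]
  linarith
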